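/- arXiv:2502.06595 — 2 statements merged into one kernel-verified Lean document; each statement's English description precedes it below -/
import Mathlib

section
/- Let T > 0, n, d ∈ ℕ, let K ⊂ ℂ^d be compact with interior K̊, let g : [0,T] × K → ℂⁿ and h : [0,T]² × ℂⁿ × K → ℂⁿ be continuous, and suppose there is L > 0 such that ‖h(t,s,u,z) − h(t,s,v,z)‖ ≤ L‖u − v‖ for all t,s ∈ [0,T], u,v ∈ ℂⁿ, z ∈ K. Assume additionally that z ↦ g(t,z) is holomorphic on K̊ for each fixed t ∈ [0,T], and that (v,z) ↦ h(t,s,v,z) is holomorphic on ℂⁿ × K̊ for each fixed (t,s) ∈ [0,T]². Then, denoting by u(·,z) the unique continuous solution of the Volterra integral equation u(t,z) = g(t,z) + ∫₀ᵗ h(t,s,u(s,z),z) ds, the map z ↦ u(t,z) is holomorphic on K̊ for every fixed t ∈ [0,T]. -/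
open Set intervalIntegral

open Metric Filter Topology MeasureTheory

section Holomorphic

variable {E F : Type*} [NormedAddCommGroup E] [NormedSpace ℂ E]
  [NormedAddCommGroup F] [NormedSpace ℂ F]

/-- A Cauchy estimate for the Fréchet derivative of a bounded holomorphic function on a ball. -/
theorem norm_fderiv_le_of_norm_le_on_ball {f : E → F} {c : E} {r C : ℝ} (hr : 0 < r)
    (hf : DifferentiableOn ℂ f (ball c r)) (hC : ∀ x ∈ ball c r, ‖f x‖ ≤ C) :
    ‖fderiv ℂ f c‖ ≤ 2 * C / r := by
  refine Complex.norm_fderiv_le_div_of_mapsTo_ball hf (fun x hx => ?_) hr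
  rw [mem_closedBall, dist_eq_norm]
  linarith [norm_sub_le (f x) (f c), hC x hx, hC c (mem_ball_self hr)]

theorem norm_fderiv_sub_le_of_norm_sub_le_on_ball {f g : E → F} {c : E} {r C : ℝ} (hr : 0 < r)
    (hf : DifferentiableOn ℂ f (ball c r)) (hg : DifferentiableOn ℂ g (ball c r))
    (hC : ∀ x ∈ ball c r, ‖f x - g x‖ ≤ C) :
    ‖fderiv ℂ f c - fderiv ℂ g c‖ ≤ 2 * C / r := by
  have hc : ball c r ∈ 𝓝 c := ball_mem_nhds c hr
  rw [← fderiv_fun_sub (hf.differentiableAt hc) (hg.differentiableAt hc)]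
  exact norm_fderiv_le_of_norm_le_on_ball hr (hf.fun_sub hg) hC

/-- A uniform limit of holomorphic functions on an open subset of a complex normed space is
holomorphic. -/
theorem differentiableOn_of_tendstoUniformlyOn [CompleteSpace F] {f : ℕ → E → F} {g : E → F}
    {U : Set E} (hU : IsOpen U) (hfg : TendstoUniformlyOn f g atTop U)
    (hf : ∀ k, DifferentiableOn ℂ (f k) U) : DifferentiableOn ℂ g U := by
  intro x hx
  obtain ⟨ε, hε, hεU⟩ := Metric.isOpen_iff.1 hU x hx
  set r := ε / 2 with hr_def
  have hr : 0 < r := by positivity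
  have hball : ∀ y ∈ ball x r, ball y r ⊆ U := fun y hy =>
    (ball_subset_ball' (by rw [mem_ball] at hy; linarith)).trans hεU
  have hcauchy : UniformCauchySeqOn (fun k => fderiv ℂ (f k)) atTop (ball x r) := by
    rw [Metric.uniformCauchySeqOn_iff]
    intro δ hδ
    obtain ⟨N, hN⟩ := Metric.uniformCauchySeqOn_iff.1 hfg.uniformCauchySeqOn (δ * r / 4)
      (by positivity)
    refine ⟨N, fun m hm k hk y hy => ?_⟩
    rw [dist_eq_norm]
    refine (norm_fderiv_sub_le_of_norm_sub_le_on_ball (C := δ * r / 4) hr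
      ((hf m).mono (hball y hy)) ((hf k).mono (hball y hy)) fun z hz => ?_).trans_lt ?_
    · rw [← dist_eq_norm]
      exact (hN m hm k hk z (hball y hy hz)).le
    · rw [show 2 * (δ * r / 4) / r = δ / 2 by field_simp; norm_num]
      linarith
  have hlim : ∀ y ∈ ball x r, ∃ A, Tendsto (fun k => fderiv ℂ (f k) y) atTop (𝓝 A) := fun y hy =>
    cauchySeq_tendsto_of_complete (hcauchy.cauchySeq hy)
  choose! g' hg' using hlim
  have hsub : ball x r ⊆ U := hball x (mem_ball_self hr)
  exact (hasFDerivAt_of_tendstoUniformlyOn isOpen_ball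
    (hcauchy.tendstoUniformlyOn_of_tendsto hg')
    (fun k y hy => ((hf k).differentiableAt (hU.mem_nhds (hsub hy))).hasFDerivAt)
    (fun y hy => hfg.tendsto_at (hsub hy))
    (mem_ball_self hr)).differentiableAt.differentiableWithinAt

/-- The derivatives of a continuous family of holomorphic functions depend continuously on the
parameter. -/
theorem continuous_fderiv_of_continuousOn [ProperSpace E] {X : Type*} [TopologicalSpace X]
    {f : X → E → F} {U : Set E} (hU : IsOpen U)
    (hf : ContinuousOn (fun p : X × E => f p.1 p.2) (univ ×ˢ U))
    (hd : ∀ s, DifferentiableOn ℂ (f s) U) {z : E} (hz : z ∈ U) :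
    Continuous fun s => fderiv ℂ (f s) z := by
  obtain ⟨r, hr, hrU⟩ := nhds_basis_closedBall.mem_iff.1 (hU.mem_nhds hz)
  rw [continuous_iff_continuousAt]
  intro s
  rw [ContinuousAt, Metric.tendsto_nhds]
  intro δ hδ
  obtain ⟨v, hv, hfv⟩ := (isCompact_closedBall z r).mem_uniformity_of_prod (f := f)
    (hf.mono (prod_mono le_rfl hrU)) (mem_univ s)
    (dist_mem_uniformity (show 0 < δ * r / 4 by positivity))
  rw [nhdsWithin_univ] at hv
  filter_upwards [hv] with q hq
  have hb : ball z r ⊆ U := ball_subset_closedBall.trans hrU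
  rw [dist_eq_norm]
  refine (norm_fderiv_sub_le_of_norm_sub_le_on_ball (C := δ * r / 4) hr
    ((hd q).mono hb) ((hd s).mono hb) fun y hy => ?_).trans_lt ?_
  · rw [← dist_eq_norm]
    exact (hfv q hq y (ball_subset_closedBall hy)).le
  · rw [show 2 * (δ * r / 4) / r = δ / 2 by field_simp; norm_num]
    linarith

/-- The integral of a continuous family of holomorphic functions is holomorphic. -/
theorem differentiableOn_intervalIntegral [ProperSpace E] {f : ℝ → E → F} {U : Set E}
    (hU : IsOpen U) (hf : ContinuousOn (fun p : ℝ × E => f p.1 p.2) (univ ×ˢ U))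
    (hd : ∀ s, DifferentiableOn ℂ (f s) U) (a b : ℝ) :
    DifferentiableOn ℂ (fun z => ∫ s in a..b, f s z) U := by
  intro z hz
  obtain ⟨ε, hε, hεU⟩ := nhds_basis_closedBall.mem_iff.1 (hU.mem_nhds hz)
  set r := ε / 2 with hr_def
  have hr : 0 < r := by positivity
  obtain ⟨C, hC⟩ := (isCompact_uIcc.prod (isCompact_closedBall z ε)).exists_bound_of_continuousOn
    (hf.mono (prod_mono (subset_univ (uIcc a b)) hεU))
  have hball : ∀ y ∈ ball z r, ball y r ⊆ closedBall z ε := fun y hy =>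
    (ball_subset_ball' (by rw [mem_ball] at hy; linarith)).trans ball_subset_closedBall
  have hsub : ball z r ⊆ U := (hball z (mem_ball_self hr)).trans hεU
  have hcont : ∀ y ∈ U, Continuous fun s => f s y := fun y hy =>
    hf.comp_continuous (f := fun s : ℝ => (s, y)) (by fun_prop) fun s => ⟨mem_univ _, hy⟩
  refine (hasFDerivAt_integral_of_dominated_of_fderiv_le (μ := volume) (F := fun z s => f s z)
    (F' := fun z s => fderiv ℂ (f s) z) (bound := fun _ => 2 * C / r) (ball_mem_nhds z hr)
    ?_ ((hcont z hz).intervalIntegrable a b)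
    (continuous_fderiv_of_continuousOn hU hf hd hz).aestronglyMeasurable ?_
    intervalIntegrable_const ?_).differentiableAt.differentiableWithinAt
  · filter_upwards [hU.mem_nhds hz] with y hy using (hcont y hy).aestronglyMeasurable
  · refine ae_of_all _ fun s hs y hy => norm_fderiv_le_of_norm_le_on_ball hr
      ((hd s).mono ((hball y hy).trans hεU)) fun x hx => ?_
    exact hC (s, x) ⟨uIoc_subset_uIcc hs, hball y hy hx⟩
  · exact ae_of_all _ fun s _ y hy =>
      ((hd s).differentiableAt (hU.mem_nhds (hsub hy))).hasFDerivAt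

end Holomorphic

section Volterra

variable {E F : Type*} [NormedAddCommGroup E] [NormedAddCommGroup F] [NormedSpace ℝ F]

/-- The Volterra operator with forcing term `g` and kernel `h`, acting on parameter-dependent
functions. -/
noncomputable def volterraOperator (g : ℝ → E → F) (h : ℝ → ℝ → F → E → F) (v : ℝ → E → F) :
    ℝ → E → F :=
  fun t z => g t z + ∫ s in (0 : ℝ)..t, h t s (v s z) z

variable {g : ℝ → E → F} {h : ℝ → ℝ → F → E → F} {K : Set E}

theorem continuousOn_volterraOperator
    (hg : ContinuousOn (fun p : ℝ × E => g p.1 p.2) (univ ×ˢ K))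
    (hh : ContinuousOn (fun p : (ℝ × ℝ) × F × E => h p.1.1 p.1.2 p.2.1 p.2.2)
      (univ ×ˢ (univ ×ˢ K)))
    {v : ℝ → E → F} (hv : ContinuousOn (fun p : ℝ × E => v p.1 p.2) (univ ×ˢ K)) :
    ContinuousOn (fun p : ℝ × E => volterraOperator g h v p.1 p.2) (univ ×ˢ K) := by
  refine hg.add ?_
  have hv' : Continuous fun q : (univ ×ˢ K : Set (ℝ × E)) × ℝ => v q.2 q.1.1.2 :=
    hv.comp_continuous (f := fun q : (univ ×ˢ K : Set (ℝ × E)) × ℝ => (q.2, q.1.1.2))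
      (by fun_prop) fun q => ⟨mem_univ _, q.1.2.2⟩
  have hh' : Continuous fun q : (univ ×ˢ K : Set (ℝ × E)) × ℝ =>
      h q.1.1.1 q.2 (v q.2 q.1.1.2) q.1.1.2 :=
    hh.comp_continuous
      (f := fun q : (univ ×ˢ K : Set (ℝ × E)) × ℝ => ((q.1.1.1, q.2), v q.2 q.1.1.2, q.1.1.2))
      (Continuous.prodMk (by fun_prop) (hv'.prodMk (by fun_prop))) fun q => ⟨mem_univ _, mem_univ _, q.1.2.2⟩
  rw [continuousOn_iff_continuous_domRestrict]
  exact continuous_parametric_intervalIntegral_of_continuous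
    (f := fun (x : (univ ×ˢ K : Set (ℝ × E))) s => h x.1.1 s (v s x.1.2) x.1.2) hh'
    (continuous_fst.comp continuous_subtype_val)

/-- In the weighted norm with weight `exp (-2 L t)`, the Volterra operator is a contraction with
constant `1 / 2`. -/
theorem norm_volterraOperator_sub_le {L T C : ℝ} (hL : 0 < L)
    (hh : ContinuousOn (fun p : (ℝ × ℝ) × F × E => h p.1.1 p.1.2 p.2.1 p.2.2)
      (univ ×ˢ (univ ×ˢ K)))
    {z : E} (hz : z ∈ K) (hLip : ∀ t s u v, ‖h t s u z - h t s v z‖ ≤ L * ‖u - v‖)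
    {v w : ℝ → E → F} (hv : Continuous fun s => v s z) (hw : Continuous fun s => w s z)
    (hvw : ∀ s ∈ Icc 0 T, ‖v s z - w s z‖ ≤ C * Real.exp (2 * L * s)) {t : ℝ} (ht : t ∈ Icc 0 T) :
    ‖volterraOperator g h v t z - volterraOperator g h w t z‖
      ≤ C / 2 * Real.exp (2 * L * t) := by
  have hint : ∀ {v : ℝ → E → F}, Continuous (fun s => v s z) →
      IntervalIntegrable (fun s => h t s (v s z) z) volume 0 t := fun {v} hv =>
    (hh.comp_continuous (f := fun s : ℝ => ((t, s), v s z, z)) (by fun_prop)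
      fun s => ⟨mem_univ _, mem_univ _, hz⟩).intervalIntegrable 0 t
  have hC : 0 ≤ C := by
    have := (norm_nonneg _).trans (hvw 0 ⟨le_rfl, ht.1.trans ht.2⟩)
    simpa using this
  have hderiv : ∀ s ∈ uIcc 0 t, HasDerivAt (fun s => C / 2 * Real.exp (2 * L * s))
      (L * (C * Real.exp (2 * L * s))) s := fun s _ => by
    refine ((((hasDerivAt_id' s).const_mul (2 * L)).exp).const_mul (C / 2)).congr_deriv ?_
    ring
  have hval : ∫ s in (0 : ℝ)..t, L * (C * Real.exp (2 * L * s))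
      = C / 2 * Real.exp (2 * L * t) - C / 2 := by
    rw [integral_eq_sub_of_hasDerivAt hderiv
      (Continuous.intervalIntegrable (by fun_prop) 0 t)]
    simp
  rw [volterraOperator, volterraOperator, add_sub_add_left_eq_sub,
    ← integral_sub (hint hv) (hint hw)]
  calc ‖∫ s in (0 : ℝ)..t, (h t s (v s z) z - h t s (w s z) z)‖
      ≤ ∫ s in (0 : ℝ)..t, L * (C * Real.exp (2 * L * s)) := by
        refine norm_integral_le_of_norm_le ht.1 (ae_of_all _ fun s hs => ?_)
          (Continuous.intervalIntegrable (by fun_prop) 0 t)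
        exact (hLip t s _ _).trans
          (mul_le_mul_of_nonneg_left (hvw s ⟨hs.1.le, hs.2.trans ht.2⟩) hL.le)
    _ ≤ C / 2 * Real.exp (2 * L * t) := by linarith

/-- The Picard iterates of the Volterra operator, started at `0`, converge to any continuous
solution, uniformly in the parameter. -/
theorem tendstoUniformlyOn_volterraOperator_iterate {L T : ℝ} (hL : 0 < L) (hK : IsCompact K)
    (hg : ContinuousOn (fun p : ℝ × E => g p.1 p.2) (univ ×ˢ K))
    (hh : ContinuousOn (fun p : (ℝ × ℝ) × F × E => h p.1.1 p.1.2 p.2.1 p.2.2)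
      (univ ×ˢ (univ ×ˢ K)))
    (hLip : ∀ t s, ∀ z ∈ K, ∀ u v, ‖h t s u z - h t s v z‖ ≤ L * ‖u - v‖)
    {u : ℝ → E → F} (hu : ∀ z ∈ K, Continuous fun t => u t z)
    (hsol : ∀ z ∈ K, ∀ t ∈ Icc 0 T, u t z = volterraOperator g h u t z)
    {t : ℝ} (ht : t ∈ Icc 0 T) :
    TendstoUniformlyOn (fun k => (volterraOperator g h)^[k] 0 t) (u t) atTop K := by
  set V : ℕ → ℝ → E → F := fun k => (volterraOperator g h)^[k] 0 with hV
  have hV_succ : ∀ k, V (k + 1) = volterraOperator g h (V k) := fun k =>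
    Function.iterate_succ_apply' _ _ _
  have hV_cont : ∀ k, ContinuousOn (fun p : ℝ × E => V k p.1 p.2) (univ ×ˢ K) := by
    intro k
    induction k with
    | zero => exact continuousOn_const
    | succ k ih => rw [hV_succ]; exact continuousOn_volterraOperator hg hh ih
  have hV_cont' : ∀ k, ∀ z ∈ K, Continuous fun s => V k s z := fun k z hz =>
    (hV_cont k).comp_continuous (f := fun s : ℝ => (s, z)) (by fun_prop)
      fun s => ⟨mem_univ _, hz⟩
  have hone_le : ∀ s ∈ Icc 0 T, 1 ≤ Real.exp (2 * L * s) := fun s hs =>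
    Real.one_le_exp (by have := hs.1; positivity)
  obtain ⟨M, hM⟩ := ((isCompact_Icc (a := (0 : ℝ)) (b := T)).prod hK).exists_bound_of_continuousOn
    ((hV_cont 1).mono (prod_mono (subset_univ _) le_rfl))
  have hdist : ∀ z ∈ K, ∀ k, ∀ s ∈ Icc 0 T,
      ‖V k s z - V (k + 1) s z‖ ≤ M / 2 ^ k * Real.exp (2 * L * s) := by
    intro z hz k
    induction k with
    | zero =>
      intro s hs
      have h1 : ‖V 1 s z‖ ≤ M := hM (s, z) ⟨hs, hz⟩
      have h0 : V 0 s z = 0 := rfl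
      rw [h0, zero_add, zero_sub, norm_neg, pow_zero, div_one]
      exact h1.trans (le_mul_of_one_le_right ((norm_nonneg _).trans h1) (hone_le s hs))
    | succ k ih =>
      intro s hs
      rw [hV_succ k, hV_succ (k + 1), pow_succ, ← div_div]
      exact norm_volterraOperator_sub_le hL hh hz (fun t s => hLip t s z hz)
        (hV_cont' k z hz) (hV_cont' (k + 1) z hz) ih hs
  have htend : ∀ z ∈ K, Tendsto (fun k => V k t z) atTop (𝓝 (u t z)) := by
    intro z hz
    obtain ⟨B, hB⟩ := (isCompact_Icc (a := (0 : ℝ)) (b := T)).exists_bound_of_continuousOn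
      (hu z hz).continuousOn
    have hbound : ∀ k, ∀ s ∈ Icc 0 T, ‖V k s z - u s z‖ ≤ B / 2 ^ k * Real.exp (2 * L * s) := by
      intro k
      induction k with
      | zero =>
        intro s hs
        have h1 := hB s hs
        have h0 : V 0 s z = 0 := rfl
        rw [h0, zero_sub, norm_neg, pow_zero, div_one]
        exact h1.trans (le_mul_of_one_le_right ((norm_nonneg _).trans h1) (hone_le s hs))
      | succ k ih =>
        intro s hs
        rw [hV_succ k, hsol z hz s hs, pow_succ, ← div_div]
        exact norm_volterraOperator_sub_le hL hh hz (fun t s => hLip t s z hz)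
          (hV_cont' k z hz) (hu z hz) ih hs
    rw [tendsto_iff_norm_sub_tendsto_zero]
    refine squeeze_zero (fun _ => norm_nonneg _) (fun k => hbound k t ht) ?_
    simpa using ((tendsto_const_nhds (x := B)).div_atTop
      (tendsto_pow_atTop_atTop_of_one_lt one_lt_two)).mul_const (Real.exp (2 * L * t))
  rw [Metric.tendstoUniformlyOn_iff]
  intro ε hε
  set D := 2 * (M * Real.exp (2 * L * t)) with hD
  have hlim : Tendsto (fun k : ℕ => D / 2 ^ k) atTop (𝓝 0) :=
    tendsto_const_nhds.div_atTop (tendsto_pow_atTop_atTop_of_one_lt one_lt_two)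
  filter_upwards [hlim.eventually_lt_const hε] with k hk z hz
  rw [dist_comm]
  refine (dist_le_of_le_geometric_two_of_tendsto (C := D) (fun k => ?_) (htend z hz) k).trans_lt hk
  rw [dist_eq_norm]
  refine (hdist z hz k t ht).trans_eq ?_
  rw [hD]
  ring

theorem differentiableOn_volterraOperator {E F : Type*} [NormedAddCommGroup E] [NormedSpace ℂ E]
    [ProperSpace E] [NormedAddCommGroup F] [NormedSpace ℂ F]
    {g : ℝ → E → F} {h : ℝ → ℝ → F → E → F} {U : Set E} (hU : IsOpen U)
    (hh : ContinuousOn (fun p : (ℝ × ℝ) × F × E => h p.1.1 p.1.2 p.2.1 p.2.2)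
      (univ ×ˢ (univ ×ˢ U)))
    (hg_hol : ∀ t, DifferentiableOn ℂ (g t) U)
    (hh_hol : ∀ t s, DifferentiableOn ℂ (fun p : F × E => h t s p.1 p.2) (univ ×ˢ U))
    {v : ℝ → E → F} (hv : ContinuousOn (fun p : ℝ × E => v p.1 p.2) (univ ×ˢ U))
    (hv_hol : ∀ t, DifferentiableOn ℂ (v t) U) (t : ℝ) :
    DifferentiableOn ℂ (volterraOperator g h v t) U := by
  refine (hg_hol t).fun_add (differentiableOn_intervalIntegral hU ?_ (fun s => ?_) 0 t)
  · exact hh.comp (f := fun p : ℝ × E => ((t, p.1), v p.1 p.2, p.2)) (by fun_prop)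
      fun p hp => ⟨mem_univ _, mem_univ _, hp.2⟩
  · exact (hh_hol t s).comp (f := fun z => (v s z, z)) ((hv_hol s).prodMk differentiableOn_id)
      fun z hz => ⟨mem_univ _, hz⟩

end Volterra

/-- **Holomorphic parameter dependence for Volterra integral equations.**
(Lemma 4.3 of the paper, holomorphy part.) Given a continuous solution `u(·,z)` of
the Volterra equation whose data `g` and `h` depend holomorphically on the parameter,
the map `z ↦ u(t,z)` is holomorphic on the interior of `K` for each fixed `t ∈ [0,T]`. -/
theorem volterra_holomorphic_dependence
    (T : ℝ) (hT : 0 < T) (n d : ℕ)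
    (K : Set (Fin d → ℂ)) (hK : IsCompact K)
    (g : ℝ → (Fin d → ℂ) → (Fin n → ℂ))
    (h : ℝ → ℝ → (Fin n → ℂ) → (Fin d → ℂ) → (Fin n → ℂ))
    (hg : ContinuousOn (fun p : ℝ × (Fin d → ℂ) => g p.1 p.2) (Icc 0 T ×ˢ K))
    (hh : ContinuousOn
      (fun p : (ℝ × ℝ) × (Fin n → ℂ) × (Fin d → ℂ) => h p.1.1 p.1.2 p.2.1 p.2.2)
      ((Icc 0 T ×ˢ Icc 0 T) ×ˢ (univ ×ˢ K)))
    (L : ℝ) (hL : 0 < L)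
    (hLip : ∀ t ∈ Icc (0:ℝ) T, ∀ s ∈ Icc (0:ℝ) T, ∀ z ∈ K, ∀ u v : Fin n → ℂ,
      ‖h t s u z - h t s v z‖ ≤ L * ‖u - v‖)
    (hg_hol : ∀ t ∈ Icc (0:ℝ) T, DifferentiableOn ℂ (fun z => g t z) (interior K))
    (hh_hol : ∀ t ∈ Icc (0:ℝ) T, ∀ s ∈ Icc (0:ℝ) T,
      DifferentiableOn ℂ (fun p : (Fin n → ℂ) × (Fin d → ℂ) => h t s p.1 p.2)
        (univ ×ˢ interior K))
    (u : ℝ → (Fin d → ℂ) → (Fin n → ℂ))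
    (hu_cont : ∀ z ∈ K, ContinuousOn (fun t => u t z) (Icc 0 T))
    (hu_sol : ∀ z ∈ K, ∀ t ∈ Icc (0:ℝ) T,
      u t z = g t z + ∫ s in (0:ℝ)..t, h t s (u s z) z) :
    ∀ t ∈ Icc (0:ℝ) T, DifferentiableOn ℂ (fun z => u t z) (interior K) := by
  set P : ℝ → ℝ := fun t => projIcc 0 T hT.le t with hP_def
  have hP : ∀ t, P t ∈ Icc 0 T := fun t => (projIcc 0 T hT.le t).2
  have hP_cont : Continuous P := continuous_subtype_val.comp continuous_projIcc
  have hP_eq : ∀ t ∈ Icc 0 T, P t = t := fun t ht => congrArg Subtype.val (projIcc_of_mem hT.le ht)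
  set G : ℝ → (Fin d → ℂ) → (Fin n → ℂ) := fun t => g (P t) with hG_def
  set H : ℝ → ℝ → (Fin n → ℂ) → (Fin d → ℂ) → (Fin n → ℂ) := fun t s => h (P t) (P s) with hH_def
  have hG : ContinuousOn (fun p : ℝ × (Fin d → ℂ) => G p.1 p.2) (univ ×ˢ K) :=
    hg.comp (f := fun p : ℝ × (Fin d → ℂ) => (P p.1, p.2)) (by fun_prop)
      fun p hp => ⟨hP _, hp.2⟩
  have hH : ContinuousOn
      (fun p : (ℝ × ℝ) × (Fin n → ℂ) × (Fin d → ℂ) => H p.1.1 p.1.2 p.2.1 p.2.2)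
      (univ ×ˢ (univ ×ˢ K)) :=
    hh.comp (f := fun p : (ℝ × ℝ) × (Fin n → ℂ) × (Fin d → ℂ) => ((P p.1.1, P p.1.2), p.2))
      (by fun_prop) fun p hp => ⟨⟨hP _, hP _⟩, hp.2⟩
  have hsol : ∀ z ∈ K, ∀ t ∈ Icc 0 T,
      u (P t) z = volterraOperator G H (fun s => u (P s)) t z := by
    intro z hz t ht
    rw [hP_eq t ht, hu_sol z hz t ht, volterraOperator, hG_def]
    simp only [hP_eq t ht]
    congr 1
    refine integral_congr fun s hs => ?_
    rw [uIcc_of_le ht.1] at hs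
    simp only [hH_def, hP_eq t ht, hP_eq s ⟨hs.1, hs.2.trans ht.2⟩]
  intro t ht
  have htend := tendstoUniformlyOn_volterraOperator_iterate (u := fun s => u (P s)) hL hK hG hH
    (fun t s z hz => hLip _ (hP t) _ (hP s) z hz)
    (fun z hz => (hu_cont z hz).comp_continuous hP_cont hP) hsol ht
  rw [hP_eq t ht] at htend
  refine differentiableOn_of_tendstoUniformlyOn isOpen_interior (htend.mono interior_subset)
    fun k => ?_
  have hsub : (univ ×ˢ interior K : Set (ℝ × (Fin d → ℂ))) ⊆ univ ×ˢ K :=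
    prod_mono le_rfl interior_subset
  have hiter : ContinuousOn
        (fun p : ℝ × (Fin d → ℂ) => (volterraOperator G H)^[k] 0 p.1 p.2) (univ ×ˢ K) ∧
      ∀ t, DifferentiableOn ℂ ((volterraOperator G H)^[k] 0 t) (interior K) := by
    induction k with
    | zero => exact ⟨continuousOn_const, fun _ => differentiableOn_const _⟩
    | succ k ih =>
      rw [Function.iterate_succ_apply']
      exact ⟨continuousOn_volterraOperator hG hH ih.1,
        differentiableOn_volterraOperator isOpen_interior
          (hH.mono (prod_mono le_rfl (prod_mono le_rfl interior_subset)))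
          (fun t => hg_hol _ (hP t)) (fun t s => hh_hol _ (hP t) _ (hP s))
          (ih.1.mono hsub) ih.2⟩
  exact hiter.2 t
end

section
/- Let T > 0, n, d ∈ ℕ, let K ⊂ ℂ^d be compact with [−1,1]^d ⊂ K, let u₀ ∈ ℂⁿ, let W : [0,T] → ℝ^{n×n} be continuous, and let C̃ : [0,T] × K → ℂ^{n×n} be continuous with C̃(t,·) holomorphic on the interior K̊ for every t ∈ [0,T]. Define M̃(t,z) = M(C̃(t,z), W(t)) (the diffusion generator). Then for every z ∈ K the initial value problem ∂ₜũ(t,z) = M̃(t,z) ũ(t,z), ũ(0,z) = u₀, has a unique solution on [0,T]; the map (t,z) ↦ ũ(t,z) is continuous on [0,T] × K; and for every fixed t ∈ [0,T] the map z ↦ ũ(t,z) is holomorphic on K̊. In particular, the parameter-to-solution map f : [−1,1]^d → ℂⁿ, f(y) = ũ(T,y), admits a holomorphic extension f̃(z) = ũ(T,z) to K̊. -/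
open Set

attribute [local instance] Matrix.normedAddCommGroup Matrix.normedSpace

/-- The diffusion generator `M(C,W) = C ⊙ W − D(C,W)`, where `⊙` is the Hadamard
product (with the real weight matrix `W` regarded as complex) and `D(C,W)` is the
diagonal matrix with `D(C,W)_{ii} = Σ_k C_{ik} W_{ik}`. -/
noncomputable def diffusionGen {n : ℕ} (C : Matrix (Fin n) (Fin n) ℂ)
    (W : Matrix (Fin n) (Fin n) ℝ) : Matrix (Fin n) (Fin n) ℂ :=
  Matrix.of fun i j =>
    C i j * (W i j : ℂ) - (if i = j then ∑ k, C i k * (W i k : ℂ) else 0)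

/-- The real cube `[−1,1]^d` viewed as a subset of `ℂ^d`. -/
def realCubeInC (d : ℕ) : Set (Fin d → ℂ) :=
  (fun (y : Fin d → ℝ) (j : Fin d) => (y j : ℂ)) '' Icc (fun _ => -1) (fun _ => 1)

open Metric Filter Topology

theorem norm_sub_sub_fderiv_le_of_mapsTo_ball {V G : Type*}
    [NormedAddCommGroup V] [NormedSpace ℂ V]
    [NormedAddCommGroup G] [NormedSpace ℂ G] {g : V → G} {c z : V} {r R : ℝ}
    (hd : DifferentiableOn ℂ g (ball c r)) (hm : MapsTo g (ball c r) (closedBall (g c) R))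
    (hz : z ∈ ball c r) :
    ‖g z - g c - fderiv ℂ g c (z - c)‖ ≤ 2 * R * (‖z - c‖ / r) ^ 2 := by
  have hr : 0 < r := nonempty_ball.1 ⟨z, hz⟩
  have hL := Complex.norm_fderiv_le_div_of_mapsTo_ball hd hm hr
  have hder : HasFDerivAt g (fderiv ℂ g c) c :=
    (hd.differentiableAt (ball_mem_nhds _ hr)).hasFDerivAt
  have key := Complex.dist_le_mul_div_pow_of_mapsTo_ball_of_isLittleO
    (f := fun w => g w - g c - fderiv ℂ g c (w - c)) (c := c) (z := z) (R₁ := r) (R₂ := 2 * R)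
    (n := 1) ?_ ?_ ?_ hz
  · simpa [dist_eq_norm] using key
  · exact (hd.sub_const _).sub (by fun_prop)
  · intro w hw
    have h1 : ‖g w - g c‖ ≤ R := by simpa [dist_eq_norm] using hm hw
    have h2 : ‖w - c‖ < r := by simpa [dist_eq_norm] using hw
    have h3 : ‖fderiv ℂ g c (w - c)‖ ≤ R := by
      calc _ ≤ R / r * ‖w - c‖ := ContinuousLinearMap.le_of_opNorm_le _ hL _
        _ ≤ R / r * r := by gcongr; exact (norm_nonneg _).trans hL
        _ = R := by field_simp
    simp only [mem_closedBall, dist_eq_norm, sub_self, map_zero, sub_zero]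
    linarith [norm_sub_le (g w - g c) (fderiv ℂ g c (w - c))]
  · simpa using (hasFDerivAt_iff_isLittleO.1 hder).norm_right

theorem differentiableOn_continuousMap_of_eval {S V G : Type*} [TopologicalSpace S] [CompactSpace S]
    [NormedAddCommGroup V] [NormedSpace ℂ V] [NormedAddCommGroup G] [NormedSpace ℂ G]
    {Φ : V → C(S, G)} {U : Set V} (hU : IsOpen U) (hc : ContinuousOn Φ U)
    (hd : ∀ s, DifferentiableOn ℂ (fun z => Φ z s) U) : DifferentiableOn ℂ Φ U := by
  intro c hcU
  obtain ⟨r, hr, hball⟩ : ∃ r > 0, ball c r ⊆ U ∩ Φ ⁻¹' closedBall (Φ c) 1 :=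
    Metric.mem_nhds_iff.1 (inter_mem (hU.mem_nhds hcU)
      ((hc.continuousAt (hU.mem_nhds hcU)) (closedBall_mem_nhds _ one_pos)))
  have hdb (s : S) : DifferentiableOn ℂ (fun z => Φ z s) (ball c r) :=
    (hd s).mono fun z hz => (hball hz).1
  have hmb (s : S) : MapsTo (fun z => Φ z s) (ball c r) (closedBall (Φ c s) 1) := fun z hz =>
    (ContinuousMap.dist_apply_le_dist s).trans (hball hz).2
  have hrem (s : S) {z : V} (hz : z ∈ ball c r) :=
    norm_sub_sub_fderiv_le_of_mapsTo_ball (hdb s) (hmb s) hz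
  let D (s : S) : V →L[ℂ] G := fderiv ℂ (fun z => Φ z s) c
  have hD (s : S) : ‖D s‖ ≤ 1 / r :=
    Complex.norm_fderiv_le_div_of_mapsTo_ball (hdb s) (hmb s) hr
  have hlim (h : V) : TendstoUniformly
      (fun (a : ℝ) s => (a : ℂ)⁻¹ • (Φ (c + (a : ℂ) • h) s - Φ c s))
      (fun s => D s h) (𝓝[>] 0) := by
    rw [Metric.tendstoUniformly_iff]
    intro ε hε
    have h1 : ∀ᶠ a : ℝ in 𝓝[>] 0, a * ‖h‖ < r :=
      nhdsWithin_le_nhds (ContinuousAt.eventually_lt (by fun_prop) (by fun_prop) (by simpa))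
    have h2 : ∀ᶠ a : ℝ in 𝓝[>] 0, 2 * a * (‖h‖ / r) ^ 2 < ε :=
      nhdsWithin_le_nhds (ContinuousAt.eventually_lt (by fun_prop) (by fun_prop) (by simpa))
    filter_upwards [h1, h2, self_mem_nhdsWithin] with a ha1 ha2 (ha : 0 < a) s
    have hn : ‖(a : ℂ) • h‖ = a * ‖h‖ := by simp [norm_smul, abs_of_pos ha]
    have hb := hrem s (z := c + (a : ℂ) • h)
      (by rwa [mem_ball, dist_eq_norm, add_sub_cancel_left, hn])
    rw [add_sub_cancel_left, hn] at hb
    have ha' : (a : ℂ) ≠ 0 := by exact_mod_cast ha.ne'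
    rw [dist_comm, dist_eq_norm]
    have : (a : ℂ)⁻¹ • (Φ (c + (a : ℂ) • h) s - Φ c s) - D s h
        = (a : ℂ)⁻¹ • (Φ (c + (a : ℂ) • h) s - Φ c s - D s ((a : ℂ) • h)) := by
      rw [map_smul, smul_sub (_ : ℂ) (_ - _), smul_smul, inv_mul_cancel₀ ha', one_smul]
    rw [this, norm_smul, norm_inv, Complex.norm_real, Real.norm_of_nonneg ha.le]
    refine lt_of_le_of_lt ?_ ha2
    calc a⁻¹ * _ ≤ a⁻¹ * (2 * 1 * (a * ‖h‖ / r) ^ 2) := by gcongr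
      _ = _ := by field_simp
  have hDc (h : V) : Continuous fun s => D s h :=
    (hlim h).continuous (Frequently.of_forall fun a => by fun_prop)
  let L : V →L[ℂ] C(S, G) := LinearMap.mkContinuous
    { toFun := fun h => ⟨fun s => D s h, hDc h⟩
      map_add' := fun x y => by ext; simp
      map_smul' := fun a x => by ext; simp } (1 / r) fun h =>
    (ContinuousMap.norm_le _ (by positivity)).2 fun s =>
      ContinuousLinearMap.le_of_opNorm_le _ (hD s) h
  refine HasFDerivAt.differentiableAt (f' := L) ?_ |>.differentiableWithinAt
  refine HasFDerivAt.of_isLittleO (Asymptotics.IsBigO.trans_isLittleO (g := fun z => ‖z - c‖ ^ 2)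
    (Asymptotics.IsBigO.of_bound (2 / r ^ 2) ?_) ?_)
  · filter_upwards [ball_mem_nhds c hr] with z hz
    refine (ContinuousMap.norm_le _ (by positivity)).2 fun s => (hrem s hz).trans_eq ?_
    simp; field_simp
  · have := (Asymptotics.isLittleO_norm_pow_id (E' := V) one_lt_two).comp_tendsto
      (k := fun z => z - c) (l' := 𝓝 c) (by simpa using (continuous_sub_right c).tendsto c)
    exact this

section FixedPoint

variable {𝕜 X Y : Type*} [NontriviallyNormedField 𝕜] [NormedAddCommGroup X] [NormedSpace 𝕜 X]
  [NormedAddCommGroup Y] [NormedSpace 𝕜 Y] (V : X →L[𝕜] Y →L[𝕜] Y) (y : Y)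

/-- The solution `w` of the affine equation `w = y + V x w`. -/
noncomputable def affineFixedPoint (x : X) : Y :=
  Ring.inverse (1 - V x) y

variable {V} {x : X}

theorem affineFixedPoint_eq (hx : IsUnit (1 - V x)) :
    affineFixedPoint V y x = y + V x (affineFixedPoint V y x) :=
  sub_eq_iff_eq_add.1 (DFunLike.congr_fun (Ring.mul_inverse_cancel _ hx) y)

variable [CompleteSpace Y]

theorem isUnit_one_sub_of_norm_pow_lt_one {f : Y →L[𝕜] Y} {k : ℕ} (hf : ‖f ^ k‖ < 1) :
    IsUnit (1 - f) := by
  have hu := isUnit_one_sub_of_norm_lt_one hf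
  rw [← mul_neg_geom_sum] at hu
  exact ((Commute.isUnit_mul_iff ((mul_neg_geom_sum _ _).trans (geom_sum_mul_neg _ _).symm)).1 hu).1

theorem differentiableAt_affineFixedPoint (hx : IsUnit (1 - V x)) :
    DifferentiableAt 𝕜 (affineFixedPoint V y) x := by
  have h : DifferentiableAt 𝕜 (fun x => Ring.inverse (1 - V x)) x :=
    (differentiableAt_inverse (𝕜 := 𝕜) hx).comp x (f := fun x => 1 - V x)
      (V.differentiableAt.const_sub 1)
  exact h.clm_apply (differentiableAt_const y)

end FixedPoint

section Volterra

variable {E : Type*} [NormedAddCommGroup E] [NormedSpace ℂ E] {T : ℝ} (hT : 0 ≤ T)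

theorem continuous_projIcc_apply (A : C(Icc 0 T, E →L[ℂ] E)) (u : C(Icc 0 T, E)) :
    Continuous fun s => A (projIcc 0 T hT s) (u (projIcc 0 T hT s)) :=
  (A.continuous.comp continuous_projIcc).clm_apply (u.continuous.comp continuous_projIcc)

variable [NormedSpace ℝ E]

/-- The function `t ↦ ∫₀ᵗ A(s) u(s) ds` on `[0, T]`. -/
noncomputable def volterraIntegral (A : C(Icc 0 T, E →L[ℂ] E)) (u : C(Icc 0 T, E)) :
    C(Icc 0 T, E) :=
  ⟨fun t => ∫ s in (0 : ℝ)..t, A (projIcc 0 T hT s) (u (projIcc 0 T hT s)),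
    (intervalIntegral.continuous_primitive
      (fun _ _ => (continuous_projIcc_apply hT A u).intervalIntegrable _ _) 0).comp
      continuous_subtype_val⟩

theorem linearODE_unique (hT : 0 ≤ T) (A : C(Icc 0 T, E →L[ℂ] E)) {v w : ℝ → E}
    (h₀ : v 0 = w 0)
    (hv : ∀ t (ht : t ∈ Icc 0 T), HasDerivWithinAt v (A ⟨t, ht⟩ (v t)) (Icc 0 T) t)
    (hw : ∀ t (ht : t ∈ Icc 0 T), HasDerivWithinAt w (A ⟨t, ht⟩ (w t)) (Icc 0 T) t) :
    EqOn v w (Icc 0 T) := by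
  have key {f : ℝ → E}
      (hf : ∀ t (ht : t ∈ Icc 0 T), HasDerivWithinAt f (A ⟨t, ht⟩ (f t)) (Icc 0 T) t) (t : ℝ)
      (ht : t ∈ Ico 0 T) : HasDerivWithinAt f (A (projIcc 0 T hT t) (f t)) (Ici t) t := by
    rw [projIcc_of_mem hT (Ico_subset_Icc_self ht)]
    exact (hf t (Ico_subset_Icc_self ht)).mono_of_mem_nhdsWithin (Icc_mem_nhdsGE_of_mem ht)
  refine ODE_solution_unique_of_mem_Icc_right (v := fun t x => A (projIcc 0 T hT t) x)
    (s := fun _ => univ) (K := ‖A‖₊) (fun t _ => LipschitzWith.lipschitzOnWith ?_)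
    (fun t ht => (hv t ht).continuousWithinAt) (key hv) (fun _ _ => mem_univ _)
    (fun t ht => (hw t ht).continuousWithinAt) (key hw) (fun _ _ => mem_univ _) h₀
  exact (A _).lipschitz.weaken (A.norm_coe_le_norm _)

variable [SMulCommClass ℝ ℂ E]

/-- The Volterra operator `u ↦ (t ↦ ∫₀ᵗ A(s) u(s) ds)`, linear in the coefficient `A`. -/
noncomputable def volterra :
    C(Icc 0 T, E →L[ℂ] E) →L[ℂ] C(Icc 0 T, E) →L[ℂ] C(Icc 0 T, E) :=
  LinearMap.mkContinuous₂
    (LinearMap.mk₂ ℂ (volterraIntegral (E := E) hT)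
      (fun A B u => by
        ext t
        exact intervalIntegral.integral_add
          ((continuous_projIcc_apply hT A u).intervalIntegrable _ _)
          ((continuous_projIcc_apply hT B u).intervalIntegrable _ _))
      (fun a A u => by
        ext t
        exact intervalIntegral.integral_smul a _)
      (fun A u v => by
        ext t
        simpa [volterraIntegral] using intervalIntegral.integral_add
          ((continuous_projIcc_apply hT A u).intervalIntegrable 0 t)
          ((continuous_projIcc_apply hT A v).intervalIntegrable 0 t))
      (fun a A u => by
        ext t
        simp [volterraIntegral]))
    T fun A u => (ContinuousMap.norm_le _ (by positivity)).2 fun t => by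
      refine (intervalIntegral.norm_integral_le_of_norm_le_const (C := ‖A‖ * ‖u‖)
        fun s _ => ?_).trans ?_
      · exact (A _).le_of_opNorm_le_of_le (A.norm_coe_le_norm _) (u.norm_coe_le_norm _)
      · rw [sub_zero, abs_of_nonneg t.2.1, mul_comm, mul_assoc]
        exact mul_le_mul_of_nonneg_right t.2.2 (by positivity)

theorem volterra_apply (A : C(Icc 0 T, E →L[ℂ] E)) (u : C(Icc 0 T, E)) (t : Icc 0 T) :
    volterra hT A u t = ∫ s in (0 : ℝ)..t, A (projIcc 0 T hT s) (u (projIcc 0 T hT s)) :=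
  rfl

theorem norm_volterra_pow_apply_le (A : C(Icc 0 T, E →L[ℂ] E)) (u : C(Icc 0 T, E)) (k : ℕ)
    (t : Icc 0 T) :
    ‖(volterra hT A ^ k) u t‖ ≤ (‖A‖ * t) ^ k / k.factorial * ‖u‖ := by
  induction k generalizing t with
  | zero => simpa using u.norm_coe_le_norm t
  | succ k ih =>
    rw [pow_succ', mul_apply_eq_comp, volterra_apply]
    refine (intervalIntegral.norm_integral_le_of_norm_le t.2.1
      (g := fun s => ‖A‖ * ((‖A‖ * s) ^ k / k.factorial * ‖u‖)) ?_
      (Continuous.intervalIntegrable (by fun_prop) _ _)).trans_eq ?_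
    · refine Eventually.of_forall fun s hs => ?_
      have hs' : s ∈ Icc 0 T := ⟨hs.1.le, hs.2.trans t.2.2⟩
      rw [projIcc_of_mem hT hs']
      exact (A _).le_of_opNorm_le_of_le (A.norm_coe_le_norm _) (ih ⟨s, hs'⟩)
    · have (s : ℝ) : ‖A‖ * ((‖A‖ * s) ^ k / k.factorial * ‖u‖)
          = ‖A‖ ^ (k + 1) / k.factorial * ‖u‖ * s ^ k := by ring
      simp_rw [this, intervalIntegral.integral_const_mul, integral_pow, Nat.factorial_succ]
      push_cast
      rw [mul_pow]
      field_simp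
      simp

theorem isUnit_one_sub_volterra [CompleteSpace E] (A : C(Icc 0 T, E →L[ℂ] E)) :
    IsUnit (1 - volterra hT A) := by
  obtain ⟨k, hk⟩ := ((FloorSemiring.tendsto_pow_div_factorial_atTop
    (‖A‖ * T)).eventually_lt_const one_pos).exists
  have hnorm : ‖volterra hT A ^ k‖ < 1 := by
    refine lt_of_le_of_lt (ContinuousLinearMap.opNorm_le_bound _ (by positivity) fun u =>
      (ContinuousMap.norm_le _ (by positivity)).2 fun t =>
        (norm_volterra_pow_apply_le hT A u k t).trans ?_) hk
    have := t.2.1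
    have := t.2.2
    gcongr
  exact isUnit_one_sub_of_norm_pow_lt_one hnorm

/-- The solution of `u' = A u`, `u 0 = u₀` on `[0, T]`. -/
noncomputable def linearODESolution (u₀ : E) (A : C(Icc 0 T, E →L[ℂ] E)) : C(Icc 0 T, E) :=
  affineFixedPoint (𝕜 := ℂ) (volterra (E := E) hT) (ContinuousMap.const _ u₀) A

variable [CompleteSpace E] (u₀ : E)

theorem differentiable_linearODESolution : Differentiable ℂ (linearODESolution hT u₀) := by
  intro A
  unfold linearODESolution
  apply differentiableAt_affineFixedPoint
  convert isUnit_one_sub_volterra hT A using 1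

theorem linearODESolution_eq (A : C(Icc 0 T, E →L[ℂ] E)) :
    linearODESolution hT u₀ A =
      ContinuousMap.const _ u₀ + volterra hT A (linearODESolution hT u₀ A) := by
  apply affineFixedPoint_eq
  convert isUnit_one_sub_volterra hT A using 1

theorem linearODESolution_apply (A : C(Icc 0 T, E →L[ℂ] E)) (t : Icc 0 T) :
    linearODESolution hT u₀ A t = u₀ + ∫ s in (0 : ℝ)..t,
      A (projIcc 0 T hT s) (linearODESolution hT u₀ A (projIcc 0 T hT s)) :=
  DFunLike.congr_fun (linearODESolution_eq hT u₀ A) t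

theorem linearODESolution_zero (A : C(Icc 0 T, E →L[ℂ] E)) :
    linearODESolution hT u₀ A (projIcc 0 T hT 0) = u₀ := by
  rw [linearODESolution_apply, projIcc_left]
  simp

theorem hasDerivWithinAt_linearODESolution (A : C(Icc 0 T, E →L[ℂ] E)) {t : ℝ}
    (ht : t ∈ Icc 0 T) :
    HasDerivWithinAt (fun s => linearODESolution hT u₀ A (projIcc 0 T hT s))
      (A ⟨t, ht⟩ (linearODESolution hT u₀ A (projIcc 0 T hT t))) (Icc 0 T) t := by
  have hc := continuous_projIcc_apply hT A (linearODESolution hT u₀ A)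
  have h := ((hc.integral_hasStrictDerivAt 0 t).hasDerivAt.const_add u₀).hasDerivWithinAt
    (s := Icc 0 T)
  rw [← projIcc_of_mem hT ht]
  refine h.congr_of_mem (fun s hs => ?_) ht
  rw [linearODESolution_apply, projIcc_of_mem hT hs]

end Volterra

theorem continuous_diffusionGen {n : ℕ} :
    Continuous fun p : Matrix (Fin n) (Fin n) ℂ × Matrix (Fin n) (Fin n) ℝ =>
      diffusionGen p.1 p.2 := by
  refine continuous_matrix fun i j => ?_
  simp only [diffusionGen, Matrix.of_apply]
  split_ifs <;> fun_prop

theorem differentiable_diffusionGen {n : ℕ} (W : Matrix (Fin n) (Fin n) ℝ) :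
    Differentiable ℂ fun C => diffusionGen C W := by
  have hentry (i j : Fin n) : Differentiable ℂ fun C : Matrix (Fin n) (Fin n) ℂ => C i j :=
    differentiable_pi.1 (differentiable_pi.1 (differentiable_id (𝕜 := ℂ)
      (E := Fin n → Fin n → ℂ)) i) j
  refine differentiable_pi.2 fun i => differentiable_pi.2 fun j => ?_
  simp only [diffusionGen, Matrix.of_apply]
  split_ifs
  · exact ((hentry i j).mul_const _).sub
      (Differentiable.fun_sum fun k _ => (hentry i k).mul_const _)
  · exact ((hentry i j).mul_const _).sub_const _

/-- The action of a square matrix on vectors, as a continuous linear map. -/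
noncomputable def mulVecCLM (n : ℕ) :
    Matrix (Fin n) (Fin n) ℂ →L[ℂ] (Fin n → ℂ) →L[ℂ] (Fin n → ℂ) :=
  LinearMap.toContinuousLinearMap
    (LinearMap.toContinuousLinearMap.toLinearMap ∘ₗ (Matrix.toLin' (R := ℂ)).toLinearMap)

theorem mulVecCLM_apply {n : ℕ} (M : Matrix (Fin n) (Fin n) ℂ) (v : Fin n → ℂ) :
    mulVecCLM n M v = M.mulVec v :=
  rfl

/-- **Holomorphy of parametric graph diffusion (Theorem 3.1, Step 1).**
Well-posedness of the parametric diffusion equation, continuity of the solution in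
`(t,z)`, and holomorphy of `z ↦ ũ(t,z)` on the interior of `K`; in particular the
parameter-to-solution map `y ↦ ũ(T,y)` on `[−1,1]^d ⊂ K` admits the holomorphic
extension `z ↦ ũ(T,z)`. -/
theorem parametric_graph_diffusion_holomorphic
    (T : ℝ) (hT : 0 < T) (n d : ℕ)
    (K : Set (Fin d → ℂ)) (hK : IsCompact K) (hcube : realCubeInC d ⊆ K)
    (u₀ : Fin n → ℂ)
    (W : ℝ → Matrix (Fin n) (Fin n) ℝ) (hW : ContinuousOn W (Icc 0 T))
    (Ct : ℝ → (Fin d → ℂ) → Matrix (Fin n) (Fin n) ℂ)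
    (hCt_cont : ContinuousOn (fun p : ℝ × (Fin d → ℂ) => Ct p.1 p.2) (Icc 0 T ×ˢ K))
    (hCt_hol : ∀ t ∈ Icc (0:ℝ) T, DifferentiableOn ℂ (fun z => Ct t z) (interior K)) :
    ∃ u : ℝ → (Fin d → ℂ) → (Fin n → ℂ),
      (∀ z ∈ K,
        u 0 z = u₀ ∧
        ∀ t ∈ Icc (0:ℝ) T,
          HasDerivWithinAt (fun t' => u t' z)
            ((diffusionGen (Ct t z) (W t)).mulVec (u t z)) (Icc 0 T) t) ∧
      (∀ z ∈ K, ∀ w : ℝ → (Fin n → ℂ),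
        w 0 = u₀ →
        (∀ t ∈ Icc (0:ℝ) T,
          HasDerivWithinAt w
            ((diffusionGen (Ct t z) (W t)).mulVec (w t)) (Icc 0 T) t) →
        ∀ t ∈ Icc (0:ℝ) T, w t = u t z) ∧
      ContinuousOn (fun p : ℝ × (Fin d → ℂ) => u p.1 p.2) (Icc 0 T ×ˢ K) ∧
      (∀ t ∈ Icc (0:ℝ) T, DifferentiableOn ℂ (fun z => u t z) (interior K)) ∧
      DifferentiableOn ℂ (fun z => u T z) (interior K) := by
  classical
  have hA : Continuous fun p : K × Icc 0 T =>
      mulVecCLM n (diffusionGen (Ct p.2 p.1) (W p.2)) := by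
    refine (mulVecCLM n).continuous.comp (continuous_diffusionGen.comp (.prodMk ?_ ?_))
    · exact hCt_cont.comp_continuous
        (f := fun p : K × Icc 0 T => ((p.2 : ℝ), (p.1 : Fin d → ℂ)))
        (by fun_prop) fun p => ⟨p.2.2, p.1.2⟩
    · exact hW.comp_continuous (by fun_prop) fun p : K × Icc 0 T => p.2.2
  let A : C(K, C(Icc 0 T, (Fin n → ℂ) →L[ℂ] (Fin n → ℂ))) := ContinuousMap.curry ⟨_, hA⟩
  let Φ (z : Fin d → ℂ) : C(Icc 0 T, (Fin n → ℂ) →L[ℂ] (Fin n → ℂ)) :=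
    if hz : z ∈ K then A ⟨z, hz⟩ else 0
  have hΦ {z : Fin d → ℂ} (hz : z ∈ K) (t : Icc 0 T) :
      Φ z t = mulVecCLM n (diffusionGen (Ct t z) (W t)) := by
    simp only [Φ, dif_pos hz]
    rfl
  have hΦc : ContinuousOn Φ K := by
    rw [continuousOn_iff_continuous_domRestrict]
    refine A.continuous.congr fun z => ?_
    simp [Φ]
  have hΦd : DifferentiableOn ℂ Φ (interior K) := by
    refine differentiableOn_continuousMap_of_eval isOpen_interior (hΦc.mono interior_subset)
      fun t => ?_
    refine DifferentiableOn.congr ?_ fun z hz => hΦ (interior_subset hz) t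
    exact (mulVecCLM n).differentiable.comp_differentiableOn
      ((differentiable_diffusionGen (W t)).comp_differentiableOn (hCt_hol t t.2))
  let u (z : Fin d → ℂ) : C(Icc 0 T, Fin n → ℂ) := linearODESolution hT.le u₀ (Φ z)
  have hud : DifferentiableOn ℂ u (interior K) :=
    (differentiable_linearODESolution hT.le u₀).comp_differentiableOn hΦd
  have huc : ContinuousOn u K :=
    (differentiable_linearODESolution hT.le u₀).continuous.comp_continuousOn hΦc
  have hol (t : ℝ) : DifferentiableOn ℂ (fun z => u z (projIcc 0 T hT.le t)) (interior K) :=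
    (ContinuousMap.evalCLM ℂ (M := Fin n → ℂ)
      (projIcc 0 T hT.le t)).differentiable.comp_differentiableOn hud
  have hderiv {z : Fin d → ℂ} (hz : z ∈ K) (t : ℝ) (ht : t ∈ Icc 0 T) :
      HasDerivWithinAt (fun s => u z (projIcc 0 T hT.le s))
        (Φ z ⟨t, ht⟩ (u z (projIcc 0 T hT.le t))) (Icc 0 T) t :=
    hasDerivWithinAt_linearODESolution hT.le u₀ (Φ z) ht
  have hzero (z : Fin d → ℂ) : u z (projIcc 0 T hT.le 0) = u₀ :=
    linearODESolution_zero hT.le u₀ (Φ z)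
  refine ⟨fun t z => u z (projIcc 0 T hT.le t), fun z hz => ⟨hzero z, fun t ht => ?_⟩,
    fun z hz w hw₀ hw => ?_, ?_, fun t _ => hol t, hol T⟩
  · simpa only [hΦ hz, mulVecCLM_apply] using hderiv hz t ht
  · refine linearODE_unique hT.le (Φ z) (hw₀.trans (hzero z).symm) (fun t ht => ?_) (hderiv hz)
    rw [hΦ hz, mulVecCLM_apply]
    exact hw t ht
  · have h1 : ContinuousOn (fun p : ℝ × (Fin d → ℂ) => u p.2) (Icc 0 T ×ˢ K) :=
      huc.comp continuousOn_snd fun p hp => hp.2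
    have h2 : ContinuousOn (fun p : ℝ × (Fin d → ℂ) => projIcc 0 T hT.le p.1) (Icc 0 T ×ˢ K) :=
      (continuous_projIcc.comp continuous_fst).continuousOn
    exact continuous_eval.comp_continuousOn (h1.prodMk h2)
end
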